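/- arXiv:math/0203063 — 2 statements merged into one kernel-verified Lean document; each statement's English description precedes it below -/
import Mathlib

section
/- Let U ⊆ ℂ be a nonempty connected open set, let f₁, …, f_α and g be functions analytic on U, suppose the Wronskian W(f₁, …, f_α) is not identically zero on U, and suppose the Wronskian W(f₁, …, f_α, g) of the α + 1 functions is identically zero on U. Then g lies in the ℂ-linear span of f₁, …, f_α (as functions on U). -/
/-- If bordering an invertible matrix `A` by a column `b`, a row `r` and a corner `s` yields a
singular matrix, then the solution `c` of `A c = b` also satisfies `r ⬝ᵥ c = s`. -/
lemma dotProduct_eq_of_det_bordered_eq_zero {K : Type*} [Field K] {n : ℕ}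
    {M : Matrix (Fin (n + 1)) (Fin (n + 1)) K} (hM : M.det = 0)
    (hA : (Matrix.of fun i j : Fin n => M i.castSucc j.castSucc).det ≠ 0)
    {c : Fin n → K}
    (hc : ∀ i : Fin n, ∑ j, M i.castSucc j.castSucc * c j = M i.castSucc (Fin.last n)) :
    ∑ j : Fin n, M (Fin.last n) j.castSucc * c j = M (Fin.last n) (Fin.last n) := by
  obtain ⟨v, hv0, hv⟩ := Matrix.exists_mulVec_eq_zero_iff.mpr hM
  have hrow (i : Fin (n + 1)) :
      ∑ j : Fin n, M i j.castSucc * v j.castSucc + M i (Fin.last n) * v (Fin.last n) = 0 := by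
    simpa [Matrix.mulVec, dotProduct, Fin.sum_univ_castSucc] using congrFun hv i
  have hw : (fun j : Fin n => v j.castSucc + v (Fin.last n) * c j) = 0 := by
    refine Matrix.eq_zero_of_mulVec_eq_zero hA (funext fun i => ?_)
    have h := hrow i.castSucc
    rw [← hc i, Finset.sum_mul, ← Finset.sum_add_distrib] at h
    simp only [Matrix.mulVec, dotProduct, Matrix.of_apply, Pi.zero_apply]
    rw [← h]
    exact Finset.sum_congr rfl fun j _ => by ring
  have hvj (j : Fin n) : v j.castSucc = -(v (Fin.last n) * c j) :=
    eq_neg_of_add_eq_zero_left (congrFun hw j)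
  have hs : v (Fin.last n) ≠ 0 := by
    intro hs
    refine hv0 (funext fun i => ?_)
    induction i using Fin.lastCases with
    | last => exact hs
    | cast j => simp [hvj, hs]
  have h := hrow (Fin.last n)
  have hsum : ∑ j : Fin n, M (Fin.last n) j.castSucc * v j.castSucc =
      -(v (Fin.last n) * ∑ j : Fin n, M (Fin.last n) j.castSucc * c j) := by
    rw [Finset.mul_sum, ← Finset.sum_neg_distrib]
    exact Finset.sum_congr rfl fun j _ => by rw [hvj]; ring
  rw [hsum] at h
  exact mul_left_cancel₀ hs (by linear_combination -h)

/-- The determinant of a matrix of differentiable functions is differentiable. -/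
lemma DifferentiableOn.matrix_det {n : Type*} [Fintype n] [DecidableEq n] {s : Set ℂ}
    {A : ℂ → Matrix n n ℂ} (hA : ∀ i j, DifferentiableOn ℂ (fun t => A t i j) s) :
    DifferentiableOn ℂ (fun t => (A t).det) s := by
  simp only [Matrix.det_apply]
  exact DifferentiableOn.fun_sum fun σ _ =>
    (DifferentiableOn.fun_finsetProd fun i _ => hA _ _).const_smul _

/-- Cramer's rule: the solution of a linear system depending differentiably on a parameter
is differentiable where the system is nonsingular. -/
lemma exists_differentiableOn_mulVec_eq {n : Type*} [Fintype n] [DecidableEq n] {s : Set ℂ}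
    {A : ℂ → Matrix n n ℂ} {b : ℂ → n → ℂ}
    (hA : ∀ i j, DifferentiableOn ℂ (fun t => A t i j) s)
    (hb : ∀ i, DifferentiableOn ℂ (fun t => b t i) s) (hdet : ∀ t ∈ s, (A t).det ≠ 0) :
    ∃ c : n → ℂ → ℂ, (∀ j, DifferentiableOn ℂ (c j) s) ∧
      ∀ t ∈ s, (A t).mulVec (fun j => c j t) = b t := by
  refine ⟨fun j t => ((A t).det)⁻¹ * (A t).cramer (b t) j, fun j => ?_, fun t ht => ?_⟩
  · refine ((DifferentiableOn.matrix_det hA).fun_inv hdet).fun_mul ?_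
    simp only [Matrix.cramer_apply]
    refine DifferentiableOn.matrix_det fun i k => ?_
    by_cases hk : k = j
    · simpa [Matrix.updateCol_apply, hk] using hb i
    · simpa [Matrix.updateCol_apply, hk] using hA i k
  · change (A t).mulVec (((A t).det)⁻¹ • (A t).cramer (b t)) = b t
    rw [Matrix.mulVec_smul, Matrix.mulVec_cramer, smul_smul, inv_mul_cancel₀ (hdet t ht), one_smul]

/-- Iterated derivatives of an analytic function are differentiable. -/
lemma AnalyticOnNhd.differentiableOn_iteratedDeriv {f : ℂ → ℂ} {s : Set ℂ}
    (hf : AnalyticOnNhd ℂ f s) (k : ℕ) : DifferentiableOn ℂ (iteratedDeriv k f) s := by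
  rw [iteratedDeriv_eq_iterate]
  exact (hf.iterated_deriv k).differentiableOn

/-- If the coefficients `c j` express `g` and its first `n` derivatives in terms of those of
`n` functions with nonvanishing Wronskian, then the `c j` have vanishing derivative. -/
lemma deriv_coeff_eq_zero_of_wronskian_ne_zero {n : ℕ} {s : Set ℂ} (hs : IsOpen s)
    {f c : Fin n → ℂ → ℂ} {g : ℂ → ℂ}
    (hf : ∀ j, AnalyticOnNhd ℂ (f j) s) (hc : ∀ j, DifferentiableOn ℂ (c j) s)
    (hdet : ∀ t ∈ s, (Matrix.of fun i j : Fin n => iteratedDeriv (i : ℕ) (f j) t).det ≠ 0)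
    (hsol : ∀ k ≤ n, ∀ t ∈ s, ∑ j, iteratedDeriv k (f j) t * c j t = iteratedDeriv k g t)
    (j : Fin n) {t : ℂ} (ht : t ∈ s) : deriv (c j) t = 0 := by
  refine congrFun (f := fun j => deriv (c j) t)
    (Matrix.eq_zero_of_mulVec_eq_zero (hdet t ht) (funext fun i => ?_)) j
  have hnhds := hs.mem_nhds ht
  have hderiv : HasDerivAt (fun z => ∑ j, iteratedDeriv (i : ℕ) (f j) z * c j z)
      (∑ j, (iteratedDeriv ((i : ℕ) + 1) (f j) t * c j t +
        iteratedDeriv (i : ℕ) (f j) t * deriv (c j) t)) t := by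
    refine HasDerivAt.fun_sum fun j _ => ?_
    rw [iteratedDeriv_succ]
    exact (((hf j).differentiableOn_iteratedDeriv i).differentiableAt hnhds).hasDerivAt.fun_mul
      ((hc j).differentiableAt hnhds).hasDerivAt
  have heq : (fun z => ∑ j, iteratedDeriv (i : ℕ) (f j) z * c j z) =ᶠ[nhds t]
      iteratedDeriv (i : ℕ) g :=
    Filter.eventuallyEq_of_mem hnhds fun z hz => hsol i i.isLt.le z hz
  have h := heq.deriv_eq
  rw [hderiv.deriv, ← iteratedDeriv_succ, Finset.sum_add_distrib,
    hsol _ (Nat.succ_le_of_lt i.isLt) t ht] at h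
  simpa [Matrix.mulVec, dotProduct] using h

/-- If the Wronskian of `f₁, …, f_α` is not identically zero on a nonempty
connected open set `U ⊆ ℂ` while the Wronskian of the `α + 1` functions
`f₁, …, f_α, g` vanishes identically on `U`, then `g` lies in the `ℂ`-linear
span of `f₁, …, f_α` as functions on `U`. -/
theorem mem_span_of_wronskian_with_extra_function_eq_zero
    (U : Set ℂ) (hUo : IsOpen U) (hUc : IsConnected U)
    (α : ℕ) (f : Fin α → ℂ → ℂ) (g : ℂ → ℂ)
    (hf : ∀ j, AnalyticOnNhd ℂ (f j) U) (hg : AnalyticOnNhd ℂ g U)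
    (hW1 : ∃ t ∈ U,
      Matrix.det (Matrix.of fun i j : Fin α => iteratedDeriv (i : ℕ) (f j) t) ≠ 0)
    (hW2 : ∀ t ∈ U,
      Matrix.det (Matrix.of fun i j : Fin (α + 1) =>
        iteratedDeriv (i : ℕ) ((Fin.snoc f g : Fin (α + 1) → ℂ → ℂ) j) t) = 0) :
    ∃ c : Fin α → ℂ, ∀ t ∈ U, g t = ∑ j, c j * f j t := by
  obtain ⟨t₀, ht₀, hdet₀⟩ := hW1
  have hdetc : ContinuousAt (fun t => Matrix.det
      (Matrix.of fun i j : Fin α => iteratedDeriv (i : ℕ) (f j) t)) t₀ :=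
    ((DifferentiableOn.matrix_det fun i j =>
      (hf j).differentiableOn_iteratedDeriv i).differentiableAt
        (hUo.mem_nhds ht₀)).continuousAt
  obtain ⟨r, hr, hball⟩ := Metric.eventually_nhds_iff_ball.mp
    ((hdetc.eventually_ne hdet₀).and (hUo.mem_nhds ht₀))
  have hBU : Metric.ball t₀ r ⊆ U := fun t ht => (hball t ht).2
  have hdet := fun t ht => (hball t ht).1
  obtain ⟨c, hcd, hc⟩ := exists_differentiableOn_mulVec_eq (s := Metric.ball t₀ r)
    (A := fun t => Matrix.of fun i j : Fin α => iteratedDeriv (i : ℕ) (f j) t)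
    (b := fun t i => iteratedDeriv (i : ℕ) g t)
    (fun i j => ((hf j).differentiableOn_iteratedDeriv i).mono hBU)
    (fun i => (hg.differentiableOn_iteratedDeriv i).mono hBU) hdet
  have hrow (i : Fin α) (t) (ht : t ∈ Metric.ball t₀ r) :
      ∑ j, iteratedDeriv (i : ℕ) (f j) t * c j t = iteratedDeriv (i : ℕ) g t := by
    simpa [Matrix.mulVec, dotProduct] using congrFun (hc t ht) i
  have hsol (k : ℕ) (hk : k ≤ α) (t) (ht : t ∈ Metric.ball t₀ r) :
      ∑ j, iteratedDeriv k (f j) t * c j t = iteratedDeriv k g t := by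
    rcases hk.lt_or_eq with hk | rfl
    · exact hrow ⟨k, hk⟩ t ht
    · simpa using dotProduct_eq_of_det_bordered_eq_zero (hW2 t (hBU ht))
        (by simpa using hdet t ht) (c := fun j => c j t) (fun i => by simpa using hrow i t ht)
  have hconst (j : Fin α) (t) (ht : t ∈ Metric.ball t₀ r) : c j t = c j t₀ :=
    Metric.isOpen_ball.is_const_of_deriv_eq_zero (convex_ball t₀ r).isPreconnected (hcd j)
      (fun z hz => deriv_coeff_eq_zero_of_wronskian_ne_zero Metric.isOpen_ball
        (fun j => (hf j).mono hBU) hcd hdet hsol j hz) ht (Metric.mem_ball_self hr)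
  refine ⟨fun j => c j t₀, ?_⟩
  have hsum : AnalyticOnNhd ℂ (fun t => ∑ j, c j t₀ * f j t) U :=
    Finset.univ.analyticOnNhd_fun_sum fun j _ => analyticOnNhd_const.mul (hf j)
  refine hg.eqOn_of_preconnected_of_eventuallyEq hsum hUc.isPreconnected ht₀
    (Filter.eventuallyEq_of_mem (Metric.ball_mem_nhds t₀ hr) fun t ht => ?_)
  have h := hsol 0 (Nat.zero_le _) t ht
  simp only [iteratedDeriv_zero] at h
  rw [← h]
  exact Finset.sum_congr rfl fun j _ => by rw [hconst j t ht, mul_comm]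
end

section
/- Let U ⊆ ℂ be an open set, let α ≥ 1, and let v : U → ℂ^α be a map each of whose coordinate functions is analytic on U. Let b ∈ U, let i ≥ α − 1 be a natural number, and suppose there exists a nonzero vector δ ∈ ℂ^α such that the standard pairing ⟨δ, v^{(k)}(b)⟩ = 0 for all 0 ≤ k ≤ i (where v^{(k)} is the k-th derivative taken coordinatewise); equivalently, v(b), v'(b), …, v^{(i)}(b) all lie in a proper linear subspace of ℂ^α. Then the analytic function A(t) = det [v(t), v'(t), …, v^{(α−1)}(t)] (the determinant of the α × α matrix with these columns) vanishes to order at least i − α + 2 at b. -/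
/-- The determinant of a matrix with analytic entries is analytic. -/
theorem AnalyticAt.matrix_det {n : Type*} [Fintype n] [DecidableEq n]
    {M : ℂ → Matrix n n ℂ} {b : ℂ} (hM : ∀ r k, AnalyticAt ℂ (fun t => M t r k) b) :
    AnalyticAt ℂ (fun t => (M t).det) b := by
  simp only [Matrix.det_apply']
  exact Finset.analyticAt_fun_sum _ fun σ _ =>
    analyticAt_const.fun_mul (Finset.analyticAt_fun_prod _ fun k _ => hM (σ k) k)

/-- The adjugate of a matrix with analytic entries has analytic entries. -/
theorem AnalyticAt.matrix_adjugate_apply {n : Type*} [Fintype n] [DecidableEq n]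
    {M : ℂ → Matrix n n ℂ} {b : ℂ} (hM : ∀ r k, AnalyticAt ℂ (fun t => M t r k) b) (r k : n) :
    AnalyticAt ℂ (fun t => (M t).adjugate r k) b := by
  simp only [Matrix.adjugate_apply]
  refine AnalyticAt.matrix_det fun p q => ?_
  by_cases hp : p = k
  · subst hp
    simpa using analyticAt_const
  · simpa [Matrix.updateRow_ne hp] using hM p q

/-- A finite sum of functions of analytic order at least `N` has order at least `N`. -/
theorem le_analyticOrderAt_finset_sum {ι : Type*} (s : Finset ι) {f : ι → ℂ → ℂ} {b : ℂ} {N : ℕ∞}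
    (hf : ∀ k ∈ s, N ≤ analyticOrderAt (f k) b) :
    N ≤ analyticOrderAt (∑ k ∈ s, f k) b := by
  classical
  induction s using Finset.induction_on with
  | empty =>
    have : analyticOrderAt (0 : ℂ → ℂ) b = ⊤ := analyticOrderAt_eq_top.2 (by simp)
    simp [this]
  | insert a s ha ih =>
    rw [Finset.sum_insert ha]
    exact (le_min (hf a (by simp)) (ih fun k hk => hf k (by simp [hk]))).trans
      le_analyticOrderAt_add

/-- If a nonzero constant row vector multiplied by an analytic matrix gives a row vector whose
entries all have order at least `N`, then the determinant has order at least `N`. -/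
theorem le_analyticOrderAt_det_of_vecMul {n : Type*} [Fintype n] [DecidableEq n]
    {M : ℂ → Matrix n n ℂ} {b : ℂ} {N : ℕ∞} (hM : ∀ r k, AnalyticAt ℂ (fun t => M t r k) b)
    {δ : n → ℂ} (hδ : δ ≠ 0)
    (hN : ∀ k, N ≤ analyticOrderAt (fun t => Matrix.vecMul δ (M t) k) b) :
    N ≤ analyticOrderAt (fun t => (M t).det) b := by
  obtain ⟨j, hj⟩ := Function.ne_iff.1 hδ
  have hdet : (fun t => (M t).det) = ∑ k, (fun t => Matrix.vecMul δ (M t) k) *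
      fun t => (M t).adjugate k j * (δ j)⁻¹ := by
    ext t
    have h : Matrix.vecMul (Matrix.vecMul δ (M t)) (M t).adjugate j = (M t).det * δ j := by
      simp [Matrix.vecMul_vecMul, Matrix.mul_adjugate, Matrix.vecMul_smul]
    rw [(eq_mul_inv_iff_mul_eq₀ hj).2 h.symm, Matrix.vecMul, dotProduct, Finset.sum_mul]
    simp [mul_assoc]
  rw [hdet]
  refine le_analyticOrderAt_finset_sum _ fun k _ => ?_
  have hw : AnalyticAt ℂ (fun t => Matrix.vecMul δ (M t) k) b := by
    simp only [Matrix.vecMul, dotProduct]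
    exact Finset.analyticAt_fun_sum _ fun r _ => analyticAt_const.mul (hM r k)
  have hadj : AnalyticAt ℂ (fun t => (M t).adjugate k j * (δ j)⁻¹) b :=
    (AnalyticAt.matrix_adjugate_apply hM k j).fun_mul analyticAt_const
  rw [analyticOrderAt_mul hw hadj]
  exact (hN k).trans le_self_add

/-- If `v : U → ℂ^α` has analytic coordinates and at `b ∈ U` the derivatives
`v(b), v'(b), …, v^{(i)}(b)` (with `i ≥ α − 1`) all annihilate a fixed nonzero
covector `δ`, then `A(t) = det [v(t), v'(t), …, v^{(α−1)}(t)]` vanishes to order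
at least `i − α + 2` at `b`. -/
theorem det_of_derivatives_vanishes_to_order
    (U : Set ℂ) (hUo : IsOpen U) (α : ℕ) (hα : 1 ≤ α)
    (v : ℂ → Fin α → ℂ)
    (hv : ∀ j, AnalyticOnNhd ℂ (fun t => v t j) U)
    (b : ℂ) (hb : b ∈ U) (i : ℕ) (hi : α - 1 ≤ i)
    (δ : Fin α → ℂ) (hδ : δ ≠ 0)
    (hpair : ∀ k ≤ i, ∑ j, δ j * iteratedDeriv k (fun t => v t j) b = 0) :
    ∀ m < i + 2 - α,
      iteratedDeriv m (fun t =>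
        Matrix.det (Matrix.of fun r k : Fin α =>
          iteratedDeriv (k : ℕ) (fun s => v s r) t)) b = 0 := by
  have han (r : Fin α) (k : ℕ) : AnalyticAt ℂ (iteratedDeriv k fun s => v s r) b := by
    rw [iteratedDeriv_eq_iterate]
    exact (hv r b hb).iterated_deriv k
  have hM (r k : Fin α) : AnalyticAt ℂ (fun t => (Matrix.of fun r k : Fin α =>
      iteratedDeriv (k : ℕ) (fun s => v s r) t) r k) b := han r k
  rw [← natCast_le_analyticOrderAt_iff_iteratedDeriv_eq_zero (AnalyticAt.matrix_det hM)]
  refine le_analyticOrderAt_det_of_vecMul hM hδ fun k => ?_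
  simp only [Matrix.vecMul, dotProduct, Matrix.of_apply]
  have hterm (r : Fin α) :
      AnalyticAt ℂ (fun t => δ r * iteratedDeriv (k : ℕ) (fun s => v s r) t) b :=
    analyticAt_const.fun_mul (han r k)
  rw [natCast_le_analyticOrderAt_iff_iteratedDeriv_eq_zero
    (Finset.analyticAt_fun_sum _ fun r _ => hterm r)]
  intro m hm
  rw [iteratedDeriv_fun_sum fun r _ => (hterm r).contDiffAt,
    ← hpair (m + k) (by omega)]
  refine Finset.sum_congr rfl fun r _ => ?_
  rw [iteratedDeriv_const_mul_field]
  simp only [iteratedDeriv_eq_iterate, Function.iterate_add_apply]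
end
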